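/- arXiv:cs/0607089 — 2 statements merged into one kernel-verified Lean document; each statement's English description precedes it below -/
import Mathlib

section
/- Let i be a nonnegative integer and γ a positive integer. Let S_{i,γ} be the set of integer sequences 0 = s_0 < s_1 < … < s_i < s_{i+1} = γ such that s_j + s_{i−j+1} ≤ γ for all j = 0, 1, …, ⌈i/2⌉, and let T_{i,γ} be the set of integer sequences 0 = t_0 < t_1 < … < t_i < t_{i+1} = γ such that Σ_{l=0}^{m} (−1)^l (t_{l+1} − t_l) ≥ 0 for all m = 0, 1, …, i. Then S_{i,γ} and T_{i,γ} are finite sets and |S_{i,γ}| = |T_{i,γ}|. -/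
/-- The set `S_{i,γ}` of strictly increasing integer sequences
`0 = s₀ < s₁ < … < s_i < s_{i+1} = γ` satisfying the symmetric-sum conditions
`s_j + s_{i-j+1} ≤ γ` for all `j = 0, 1, …, ⌈i/2⌉`. -/
def Sset (i γ : ℕ) : Set (Fin (i + 2) → ℕ) :=
  {s | s 0 = 0 ∧ s (Fin.last (i + 1)) = γ ∧ StrictMono s ∧
    ∀ (j : ℕ) (hj : j ≤ (i + 1) / 2),
      s ⟨j, by omega⟩ + s ⟨i - j + 1, by omega⟩ ≤ γ}

/-- The set `T_{i,γ}` of strictly increasing integer sequences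
`0 = t₀ < t₁ < … < t_i < t_{i+1} = γ` all of whose alternating partial sums
`Σ_{l=0}^{m} (−1)^l (t_{l+1} − t_l)` for `m = 0, 1, …, i` are nonnegative. -/
def Tset (i γ : ℕ) : Set (Fin (i + 2) → ℕ) :=
  {t | t 0 = 0 ∧ t (Fin.last (i + 1)) = γ ∧ StrictMono t ∧
    ∀ (m : ℕ) (hm : m ≤ i),
      0 ≤ ∑ l : Fin (m + 1), (-1 : ℤ) ^ (l : ℕ) *
        ((t (Fin.castLE (by omega) l.succ) : ℤ) -
          (t (Fin.castLE (by omega) (Fin.castSucc l)) : ℤ))}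

open Finset

/-- The alternating sum of the first `m` increments of `x`. -/
def altSum (x : ℕ → ℤ) (m : ℕ) : ℤ :=
  ∑ l ∈ range m, (-1 : ℤ) ^ l * (x (l + 1) - x l)

theorem altSum_succ (x : ℕ → ℤ) (m : ℕ) :
    altSum x (m + 1) = altSum x m + (-1 : ℤ) ^ m * (x (m + 1) - x m) :=
  sum_range_succ _ _

theorem altSum_congr {x y : ℕ → ℤ} {m : ℕ} (h : ∀ k ≤ m, x k = y k) :
    altSum x m = altSum y m := by
  refine sum_congr rfl fun l hl => ?_
  have := mem_range.1 hl
  rw [h l (by omega), h (l + 1) (by omega)]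

theorem lt_of_lt_succ_of_le {x : ℕ → ℤ} {n : ℕ} (h : ∀ j < n, x j < x (j + 1)) {a b : ℕ}
    (hab : a < b) (hb : b ≤ n) : x a < x b := by
  induction b, hab using Nat.le_induction with
  | base => exact h a (by omega)
  | succ b _ ih => exact (ih (by omega)).trans (h b (by omega))

theorem strictMono_iff_of_cast_eq {i : ℕ} {s : Fin (i + 2) → ℕ} {x : ℕ → ℤ}
    (hx : ∀ k, (s k : ℤ) = x k) : StrictMono s ↔ ∀ j < i + 1, x j < x (j + 1) := by
  constructor
  · intro h j hj
    have h1 := hx ⟨j, by omega⟩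
    have h2 := hx ⟨j + 1, by omega⟩
    have h3 : s ⟨j, by omega⟩ < s ⟨j + 1, by omega⟩ := h (by simp)
    simp only at h1 h2
    omega
  · intro h a b hab
    have := lt_of_lt_succ_of_le h (Fin.lt_def.1 hab) (by omega)
    rw [← hx, ← hx] at this
    exact_mod_cast this

theorem mem_Sset_iff_of_cast_eq {i γ : ℕ} {s : Fin (i + 2) → ℕ} {x : ℕ → ℤ}
    (hx : ∀ k, (s k : ℤ) = x k) :
    s ∈ Sset i γ ↔ x 0 = 0 ∧ x (i + 1) = γ ∧ (∀ j < i + 1, x j < x (j + 1)) ∧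
      ∀ j, 2 * j ≤ i + 1 → x j + x (i + 1 - j) ≤ γ := by
  have h0 := hx 0
  have hl := hx (Fin.last (i + 1))
  simp only [Fin.val_zero, Fin.val_last] at h0 hl
  simp only [Sset, Set.mem_ofPred_eq, strictMono_iff_of_cast_eq hx]
  refine and_congr (by omega) (and_congr (by omega) (and_congr Iff.rfl ?_))
  have key : ∀ (j : ℕ) (hj : j ≤ (i + 1) / 2),
      s ⟨j, by omega⟩ + s ⟨i - j + 1, by omega⟩ ≤ γ ↔ x j + x (i + 1 - j) ≤ γ := by
    intro j hj
    have h1 := hx ⟨j, by omega⟩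
    have h2 := hx ⟨i - j + 1, by omega⟩
    simp only at h1 h2
    by_cases hji : j ≤ i
    · rw [show i + 1 - j = i - j + 1 by omega]
      omega
    · omega
  exact ⟨fun h j hj => (key j (by omega)).1 (h j (by omega)),
    fun h j hj => (key j hj).2 (h j (by omega))⟩

theorem mem_Tset_iff_of_cast_eq {i γ : ℕ} {t : Fin (i + 2) → ℕ} {x : ℕ → ℤ}
    (hx : ∀ k, (t k : ℤ) = x k) :
    t ∈ Tset i γ ↔ x 0 = 0 ∧ x (i + 1) = γ ∧ (∀ j < i + 1, x j < x (j + 1)) ∧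
      ∀ m ≤ i, 0 ≤ altSum x (m + 1) := by
  have h0 := hx 0
  have hl := hx (Fin.last (i + 1))
  simp only [Fin.val_zero, Fin.val_last] at h0 hl
  simp only [Tset, Set.mem_ofPred_eq, strictMono_iff_of_cast_eq hx]
  refine and_congr (by omega) (and_congr (by omega) (and_congr Iff.rfl ?_))
  refine forall_congr' fun m => forall_congr' fun hm => ?_
  simp only [hx, altSum, Finset.sum_range, Fin.val_castLE, Fin.val_succ, Fin.val_castSucc]

/-- The sequence `t` obtained from `s` by listing the increments of `s` in the order
last, first, second to last, second, and so on. -/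
def interleave (n : ℕ) (x : ℕ → ℤ) (m : ℕ) : ℤ :=
  x n + x (m / 2) - x (n - (m + 1) / 2)

theorem altSum_interleave {n : ℕ} {x : ℕ → ℤ} (h0 : x 0 = 0) {m : ℕ} :
    altSum (interleave n x) m = x n - x (n - (m + 1) / 2) - x (m / 2) := by
  induction m with
  | zero => simp [altSum, h0]
  | succ m ih =>
    rw [altSum_succ, ih]
    obtain ⟨k, rfl | rfl⟩ := Nat.even_or_odd' m
    · simp only [interleave, show (2 * k + 1) / 2 = k by omega, show 2 * k / 2 = k by omega,
        show (2 * k + 1 + 1) / 2 = k + 1 by omega, pow_mul]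
      ring
    · simp only [interleave, show (2 * k + 1) / 2 = k by omega,
        show (2 * k + 1 + 1 + 1) / 2 = k + 1 by omega,
        show (2 * k + 1 + 1) / 2 = k + 1 by omega, pow_succ, pow_mul]
      ring

theorem interleave_lt_succ {n : ℕ} {x : ℕ → ℤ} (h : ∀ j < n, x j < x (j + 1)) {m : ℕ}
    (hm : m < n) : interleave n x m < interleave n x (m + 1) := by
  obtain ⟨k, rfl | rfl⟩ := Nat.even_or_odd' m
  · have := h (n - (k + 1)) (by omega)
    rw [show n - (k + 1) + 1 = n - k by omega] at this
    simp only [interleave, show (2 * k + 1) / 2 = k by omega, show 2 * k / 2 = k by omega,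
        show (2 * k + 1 + 1) / 2 = k + 1 by omega]
    omega
  · have := h k (by omega)
    simp only [interleave, show (2 * k + 1) / 2 = k by omega,
        show (2 * k + 1 + 1 + 1) / 2 = k + 1 by omega,
        show (2 * k + 1 + 1) / 2 = k + 1 by omega]
    omega

/-- The sum of the first `k` increments of `x` at even positions. -/
def evenSum (x : ℕ → ℤ) (k : ℕ) : ℤ := ∑ l ∈ range k, (x (2 * l + 1) - x (2 * l))

/-- The sum of the first `k` increments of `x` at odd positions. -/
def oddSum (x : ℕ → ℤ) (k : ℕ) : ℤ := ∑ l ∈ range k, (x (2 * l + 2) - x (2 * l + 1))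

theorem evenSum_succ (x : ℕ → ℤ) (k : ℕ) :
    evenSum x (k + 1) = evenSum x k + (x (2 * k + 1) - x (2 * k)) :=
  sum_range_succ _ _

theorem oddSum_succ (x : ℕ → ℤ) (k : ℕ) :
    oddSum x (k + 1) = oddSum x k + (x (2 * k + 2) - x (2 * k + 1)) :=
  sum_range_succ _ _

theorem evenSum_add_oddSum {x : ℕ → ℤ} (h0 : x 0 = 0) (k : ℕ) :
    evenSum x k + oddSum x k = x (2 * k) := by
  induction k with
  | zero => simp [evenSum, oddSum, h0]
  | succ k ih =>
    rw [evenSum_succ, oddSum_succ, show 2 * (k + 1) = 2 * k + 2 by ring]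
    omega

theorem altSum_two_mul (x : ℕ → ℤ) (k : ℕ) : altSum x (2 * k) = evenSum x k - oddSum x k := by
  induction k with
  | zero => simp [evenSum, oddSum, altSum]
  | succ k ih =>
    rw [evenSum_succ, oddSum_succ, show 2 * (k + 1) = 2 * k + 1 + 1 by ring, altSum_succ,
      altSum_succ, ih]
    simp only [pow_succ, pow_mul]
    ring

/-- The inverse of `interleave`. -/
def unleave (n : ℕ) (x : ℕ → ℤ) (j : ℕ) : ℤ :=
  if 2 * j ≤ n then oddSum x j else x n - evenSum x (n - j)

theorem unleave_sub {n : ℕ} {x : ℕ → ℤ} (h0 : x 0 = 0) {k : ℕ} (hk : 2 * k ≤ n + 1)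
    (hkn : k ≤ n) : unleave n x (n - k) = x n - evenSum x k := by
  unfold unleave
  have hP := evenSum_add_oddSum h0
  split_ifs with h
  · rcases (show n = 2 * k ∨ n + 1 = 2 * k by omega) with rfl | h'
    · rw [show 2 * k - k = k by omega]
      linarith [hP k]
    · obtain ⟨j, rfl⟩ : ∃ j, k = j + 1 := ⟨k - 1, by omega⟩
      obtain rfl : n = 2 * j + 1 := by omega
      rw [show 2 * j + 1 - (j + 1) = j by omega, evenSum_succ]
      linarith [hP j]
  · rw [show n - (n - k) = k by omega]

theorem unleave_lt_succ {n : ℕ} {x : ℕ → ℤ} (h0 : x 0 = 0) (h : ∀ j < n, x j < x (j + 1))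
    {j : ℕ} (hj : j < n) : unleave n x j < unleave n x (j + 1) := by
  by_cases hjn : 2 * (j + 1) ≤ n
  · rw [unleave, unleave, if_pos (by omega), if_pos hjn, oddSum_succ]
    linarith [h (2 * j + 1) (by omega)]
  · obtain ⟨k, hk⟩ : ∃ k, n = j + 1 + k := ⟨n - (j + 1), by omega⟩
    have h1 := unleave_sub h0 (n := n) (k := k) (by omega) (by omega)
    have h2 := unleave_sub h0 (n := n) (k := k + 1) (by omega) (by omega)
    rw [show n - k = j + 1 by omega] at h1
    rw [show n - (k + 1) = j by omega, evenSum_succ] at h2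
    linarith [h (2 * k) (by omega)]

theorem interleave_unleave {n : ℕ} {x : ℕ → ℤ} (hn : 0 < n) (h0 : x 0 = 0) {m : ℕ}
    (hm : m ≤ n) : interleave n (unleave n x) m = x m := by
  have hn0 := unleave_sub h0 (n := n) (k := 0) (by omega) (by omega)
  have hE0 : evenSum x 0 = 0 := rfl
  have hP := evenSum_add_oddSum h0 (m / 2)
  have h1 := unleave_sub h0 (n := n) (k := (m + 1) / 2) (by omega) (by omega)
  have h2 : unleave n x (m / 2) = oddSum x (m / 2) := if_pos (by omega)
  rw [Nat.sub_zero] at hn0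
  rw [interleave, hn0, h1, h2]
  obtain ⟨k, rfl | rfl⟩ := Nat.even_or_odd' m
  · rw [show 2 * k / 2 = k by omega] at *
    rw [show (2 * k + 1) / 2 = k by omega]
    omega
  · rw [show (2 * k + 1) / 2 = k by omega] at *
    rw [show (2 * k + 1 + 1) / 2 = k + 1 by omega, evenSum_succ]
    omega

/-- Extension of a finite sequence of naturals to an integer sequence on `ℕ`. -/
def extendSeq {i : ℕ} (s : Fin (i + 2) → ℕ) (k : ℕ) : ℤ := s (Fin.ofNat (i + 2) k)

theorem cast_eq_extendSeq {i : ℕ} (s : Fin (i + 2) → ℕ) (k : Fin (i + 2)) :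
    (s k : ℤ) = extendSeq s k := by
  simp [extendSeq]

theorem cast_toNat_eq {n : ℕ} {x : ℕ → ℤ} (h0 : x 0 = 0) (h : ∀ j < n, x j < x (j + 1))
    (k : Fin (n + 1)) : ((x k).toNat : ℤ) = x k := by
  refine Int.toNat_of_nonneg ?_
  rcases Nat.eq_zero_or_pos (k : ℕ) with hk | hk
  · rw [hk, h0]
  · exact h0 ▸ (lt_of_lt_succ_of_le h hk (by omega)).le

theorem finite_of_strictMono_of_last_eq {i γ : ℕ} {A : Set (Fin (i + 2) → ℕ)}
    (h : ∀ s ∈ A, StrictMono s ∧ s (Fin.last (i + 1)) = γ) : A.Finite := by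
  refine (Set.finite_Iic (fun _ : Fin (i + 2) => γ)).subset fun s hs k => ?_
  exact (h s hs).2 ▸ (h s hs).1.monotone (Fin.le_last k)

/-- The map `Sset i γ → Tset i γ` reordering the increments. -/
def interleaveSeq {i : ℕ} (s : Fin (i + 2) → ℕ) (k : Fin (i + 2)) : ℕ :=
  (interleave (i + 1) (extendSeq s) k).toNat

theorem cast_interleaveSeq {i γ : ℕ} {s : Fin (i + 2) → ℕ} (hs : s ∈ Sset i γ)
    (k : Fin (i + 2)) : (interleaveSeq s k : ℤ) = interleave (i + 1) (extendSeq s) k := by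
  obtain ⟨h0, -, hlt, -⟩ := (mem_Sset_iff_of_cast_eq (cast_eq_extendSeq s)).1 hs
  exact cast_toNat_eq (n := i + 1) (by simp [interleave, h0])
    (fun _ => interleave_lt_succ hlt) k

theorem interleaveSeq_mem_Tset {i γ : ℕ} {s : Fin (i + 2) → ℕ} (hs : s ∈ Sset i γ) :
    interleaveSeq s ∈ Tset i γ := by
  rw [mem_Tset_iff_of_cast_eq (cast_interleaveSeq hs)]
  obtain ⟨h0, hl, hlt, hc⟩ := (mem_Sset_iff_of_cast_eq (cast_eq_extendSeq s)).1 hs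
  refine ⟨by simp [interleave, h0], ?_, fun _ => interleave_lt_succ hlt, fun m hm => ?_⟩
  · rw [interleave, hl, show i + 1 - (i + 1 + 1) / 2 = (i + 1) / 2 by omega]
    ring
  · rw [altSum_interleave h0, hl]
    have h1 := hc ((m + 1) / 2) (by omega)
    rcases (show (m + 1 + 1) / 2 = (m + 1) / 2 ∨ (m + 1 + 1) / 2 = (m + 1) / 2 + 1 by omega)
      with h | h
    · rw [h]
      omega
    · have h2 := hlt (i + 1 - ((m + 1) / 2 + 1)) (by omega)
      rw [show i + 1 - ((m + 1) / 2 + 1) + 1 = i + 1 - (m + 1) / 2 by omega] at h2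
      rw [h]
      omega

theorem interleaveSeq_injOn (i γ : ℕ) : Set.InjOn interleaveSeq (Sset i γ) := by
  intro s hs s' hs' heq
  obtain ⟨h0, hl, -, -⟩ := (mem_Sset_iff_of_cast_eq (cast_eq_extendSeq s)).1 hs
  obtain ⟨h0', hl', -, -⟩ := (mem_Sset_iff_of_cast_eq (cast_eq_extendSeq s')).1 hs'
  have hI : ∀ k ≤ i + 1, interleave (i + 1) (extendSeq s) k =
      interleave (i + 1) (extendSeq s') k := by
    intro k hk
    have h1 := cast_interleaveSeq hs ⟨k, by omega⟩
    have h2 := cast_interleaveSeq hs' ⟨k, by omega⟩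
    rw [← h1, ← h2, heq]
  have key : ∀ k, 2 * k ≤ i + 1 → extendSeq s k = extendSeq s' k ∧
      extendSeq s (i + 1 - k) = extendSeq s' (i + 1 - k) := by
    intro k hk
    have h1 := hI _ hk
    have h2 := altSum_congr fun j hj => hI j (hj.trans hk)
    rw [altSum_interleave h0, altSum_interleave h0'] at h2
    simp only [interleave, show 2 * k / 2 = k by omega, show (2 * k + 1) / 2 = k by omega]
      at h1 h2
    omega
  funext k
  have hk : extendSeq s k = extendSeq s' k := by
    by_cases h : 2 * (k : ℕ) ≤ i + 1
    · exact (key k h).1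
    · have := (key (i + 1 - k) (by omega)).2
      rwa [show i + 1 - (i + 1 - (k : ℕ)) = k by omega] at this
  rw [← cast_eq_extendSeq, ← cast_eq_extendSeq] at hk
  exact_mod_cast hk

theorem exists_interleaveSeq_eq {i γ : ℕ} {t : Fin (i + 2) → ℕ} (ht : t ∈ Tset i γ) :
    ∃ s ∈ Sset i γ, interleaveSeq s = t := by
  obtain ⟨h0, hl, hlt, hc⟩ := (mem_Tset_iff_of_cast_eq (cast_eq_extendSeq t)).1 ht
  set x := extendSeq t with hx
  set y := unleave (i + 1) x with hy
  have hy0 : y 0 = 0 := by simp [hy, unleave, oddSum]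
  have hyl : y (i + 1) = γ := by
    have := unleave_sub h0 (n := i + 1) (k := 0) (by omega) (by omega)
    simpa [evenSum, hl] using this
  have hylt : ∀ j < i + 1, y j < y (j + 1) := fun j => unleave_lt_succ h0 hlt
  have hcast := cast_toNat_eq hy0 hylt
  let s : Fin (i + 2) → ℕ := fun k => (y k).toNat
  have hs : s ∈ Sset i γ := by
    rw [mem_Sset_iff_of_cast_eq (s := s) hcast]
    refine ⟨hy0, hyl, hylt, fun j hj => ?_⟩
    have h1 := unleave_sub h0 (n := i + 1) (k := j) (by omega) (by omega)
    have h2 : y j = oddSum x j := if_pos hj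
    have h3 : 0 ≤ altSum x (2 * j) := by
      rcases Nat.eq_zero_or_pos j with rfl | hj0
      · simp [altSum]
      · have := hc (2 * j - 1) (by omega)
        rwa [show 2 * j - 1 + 1 = 2 * j by omega] at this
    rw [altSum_two_mul] at h3
    rw [← hy] at h1
    omega
  refine ⟨s, hs, funext fun k => ?_⟩
  have hsy : ∀ j ≤ i + 1, extendSeq s j = y j := fun j hj =>
    (cast_eq_extendSeq s ⟨j, by omega⟩).symm.trans (hcast ⟨j, by omega⟩)
  have h1 := cast_interleaveSeq hs k
  rw [interleave, hsy _ le_rfl, hsy _ (by omega), hsy _ (by omega)] at h1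
  have h2 : interleave (i + 1) y k = x k := interleave_unleave (by omega) h0 (by omega)
  rw [interleave] at h2
  rw [h2, hx, ← cast_eq_extendSeq] at h1
  exact_mod_cast h1

/-- `S_{i,γ}` and `T_{i,γ}` are finite sets of the same cardinality. -/
theorem Sset_Tset_card_eq (i γ : ℕ) (hγ : 0 < γ) :
    (Sset i γ).Finite ∧ (Tset i γ).Finite ∧ (Sset i γ).ncard = (Tset i γ).ncard := by
  refine ⟨finite_of_strictMono_of_last_eq fun s hs => ⟨hs.2.2.1, hs.2.1⟩,
    finite_of_strictMono_of_last_eq fun t ht => ⟨ht.2.2.1, ht.2.1⟩, ?_⟩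
  exact Set.ncard_congr (fun s _ => interleaveSeq s) (fun _ => interleaveSeq_mem_Tset)
    (fun _ _ hs hs' h => interleaveSeq_injOn i γ hs hs' h)
    (fun _ ht => by simpa using exists_interleaveSeq_eq ht)
end

section
/- Let γ be a positive integer and let C_n := (1/(n+1))·binom(2n, n) denote the n-th Catalan number. Let F be a finite field with |F| > (1/2)·(C_{γ−1} + binom(γ−1, ⌊(γ−1)/2⌋)). Then there exists a γ×γ superregular matrix over F. -/
/-- A square matrix is a lower triangular Toeplitz matrix if its entries below
and on the diagonal depend only on the difference of the indices, determined by
the first column, and the entries above the diagonal vanish. -/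
def IsLTToeplitz {F : Type*} [CommRing F] {m : ℕ}
    (A : Matrix (Fin m) (Fin m) F) : Prop :=
  ∃ a : ℕ → F, ∀ r c : Fin m,
    A r c = if (c : ℕ) ≤ (r : ℕ) then a ((r : ℕ) - (c : ℕ)) else 0

/-- A square matrix is superregular if it is a lower triangular Toeplitz matrix
and every proper submatrix (rows `i₁ < … < iₛ`, columns `j₁ < … < jₛ` with
`jᵥ ≤ iᵥ` for all `ν`) has a nonzero determinant. -/
def Superregular {F : Type*} [CommRing F] {m : ℕ}
    (A : Matrix (Fin m) (Fin m) F) : Prop :=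
  IsLTToeplitz A ∧
  ∀ (s : ℕ) (i j : Fin s → Fin m), StrictMono i → StrictMono j →
    (∀ ν : Fin s, (j ν : ℕ) ≤ (i ν : ℕ)) → (A.submatrix i j).det ≠ 0

/-- The ballot words of length `m` with `k` down-steps, encoded by the set of positions of their
down-steps: no initial segment contains more down-steps than up-steps. -/
def ballotWords (m k : ℕ) : Finset (Finset ℕ) :=
  {D ∈ (Finset.range m).powerset |
    Nat.count (· ∈ D) m = k ∧ ∀ t ≤ m, 2 * Nat.count (· ∈ D) t ≤ t}

theorem mem_ballotWords {m k : ℕ} {D : Finset ℕ} :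
    D ∈ ballotWords m k ↔ D ⊆ Finset.range m ∧ Nat.count (· ∈ D) m = k ∧
      ∀ t ≤ m, 2 * Nat.count (· ∈ D) t ≤ t := by
  simp [ballotWords]

theorem count_mem_congr {D E : Finset ℕ} {m : ℕ} (h : ∀ p < m, (p ∈ D ↔ p ∈ E)) {t : ℕ}
    (ht : t ≤ m) : Nat.count (· ∈ D) t = Nat.count (· ∈ E) t := by
  rw [Nat.count_eq_card_filter_range, Nat.count_eq_card_filter_range]
  congr 1
  ext p
  simp only [Finset.mem_filter, Finset.mem_range, and_congr_right_iff]
  exact fun hp => h p (hp.trans_le ht)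

theorem ballotWords_eq_empty {m k : ℕ} (h : m < 2 * k) : ballotWords m k = ∅ := by
  refine Finset.eq_empty_of_forall_notMem fun D hD => ?_
  obtain ⟨-, h1, h2⟩ := mem_ballotWords.1 hD
  have := h2 m le_rfl
  omega

theorem card_ballotWords_zero_le (m : ℕ) : (ballotWords m 0).card ≤ 1 := by
  refine Finset.card_le_one.2 fun D hD E hE => ?_
  have key : ∀ D ∈ ballotWords m 0, D = ∅ := by
    intro D hD
    obtain ⟨h0, h1, -⟩ := mem_ballotWords.1 hD
    rw [Nat.count_eq_card_filter_range, Finset.card_eq_zero] at h1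
    refine Finset.eq_empty_of_forall_notMem fun p hp => ?_
    have : p ∈ (Finset.range m).filter (· ∈ D) := Finset.mem_filter.2 ⟨h0 hp, hp⟩
    simp [h1] at this
  rw [key D hD, key E hE]

theorem card_ballotWords_succ_le (m k : ℕ) :
    (ballotWords (m + 1) (k + 1)).card ≤
      (ballotWords m k).card + (ballotWords m (k + 1)).card := by
  have hsub : ballotWords (m + 1) (k + 1) ⊆
      (ballotWords m k).image (insert m) ∪ ballotWords m (k + 1) := by
    intro D hD
    obtain ⟨h0, h1, h2⟩ := mem_ballotWords.1 hD
    rw [Nat.count_succ] at h1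
    rw [Finset.mem_union]
    by_cases hm : m ∈ D
    · left
      have hc : ∀ p < m, (p ∈ D.erase m ↔ p ∈ D) := by
        intro p hp
        simp [hp.ne]
      refine Finset.mem_image.2 ⟨D.erase m, mem_ballotWords.2 ⟨?_, ?_, ?_⟩,
        Finset.insert_erase hm⟩
      · intro p hp
        have := Finset.mem_range.1 (h0 (Finset.mem_of_mem_erase hp))
        have := Finset.ne_of_mem_erase hp
        exact Finset.mem_range.2 (by omega)
      · rw [count_mem_congr hc le_rfl]
        simpa [hm] using h1
      · intro t ht
        rw [count_mem_congr hc ht]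
        exact h2 t (by omega)
    · right
      refine mem_ballotWords.2 ⟨?_, by simpa [hm] using h1, fun t ht => h2 t (by omega)⟩
      intro p hp
      have := Finset.mem_range.1 (h0 hp)
      have : p ≠ m := fun h => hm (h ▸ hp)
      exact Finset.mem_range.2 (by omega)
  calc _ ≤ _ := Finset.card_le_card hsub
    _ ≤ _ := Finset.card_union_le _ _
    _ ≤ _ := Nat.add_le_add_right Finset.card_image_le _

theorem card_ballotWords_add_choose_le (m k : ℕ) (h : 2 * (k + 1) ≤ m + 1) :
    (ballotWords m (k + 1)).card + m.choose k ≤ m.choose (k + 1) := by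
  induction m generalizing k with
  | zero => omega
  | succ m ih =>
    rcases h.lt_or_eq with h | h
    · have h1 := card_ballotWords_succ_le m k
      have h2 := ih k (by omega)
      have h4 := Nat.choose_succ_succ' m k
      cases k with
      | zero =>
        have h3 := card_ballotWords_zero_le m
        simp at *
        omega
      | succ k =>
        have h3 := ih k (by omega)
        have h5 := Nat.choose_succ_succ' m k
        omega
    · rw [ballotWords_eq_empty (by omega), Finset.card_empty, zero_add]
      refine (Nat.choose_symm_of_eq_add ?_).le
      omega

theorem sum_card_ballotWords_le (m K : ℕ) (h : 2 * K ≤ m) :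
    ∑ k ∈ Finset.range (K + 1), (ballotWords m k).card ≤ m.choose K := by
  induction K with
  | zero => simpa using card_ballotWords_zero_le m
  | succ K ih =>
    rw [Finset.sum_range_succ]
    have h1 := ih (by omega)
    have h2 := card_ballotWords_add_choose_le m K (by omega)
    omega

theorem card_ballotWords_le_catalan (n : ℕ) : (ballotWords (2 * n) n).card ≤ catalan n := by
  cases n with
  | zero => simpa using card_ballotWords_zero_le 0
  | succ n =>
    have h1 := card_ballotWords_add_choose_le (2 * (n + 1)) n (by omega)
    have h2 := Nat.choose_succ_right_eq (2 * (n + 1)) n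
    have h3 := succ_mul_catalan_eq_centralBinom (n + 1)
    rw [Nat.centralBinom] at h3
    have h4 : 2 * (n + 1) - n = n + 2 := by omega
    rw [h4] at h2
    refine Nat.le_of_mul_le_mul_left (c := n + 1 + 1) ?_ (Nat.succ_pos _)
    rw [h3]
    nlinarith

/-- The ballot word read backwards with up-steps and down-steps interchanged. -/
def reverseWord (n : ℕ) (D : Finset ℕ) : Finset ℕ :=
  {p ∈ Finset.range (2 * n) | 2 * n - 1 - p ∉ D}

theorem card_symmetric_ballotWords_le (n : ℕ) :
    {D ∈ ballotWords (2 * n) n | reverseWord n D = D}.card ≤ n.choose (n / 2) := by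
  refine le_trans ?_ (sum_card_ballotWords_le n (n / 2) (by omega))
  refine le_trans ?_ (Finset.card_biUnion_le (s := Finset.range (n / 2 + 1))
    (t := ballotWords n))
  refine Finset.card_le_card_of_injOn (fun D => D ∩ Finset.range n) ?_ ?_
  · intro D hD
    obtain ⟨hD, -⟩ := Finset.mem_filter.1 hD
    obtain ⟨-, -, h2⟩ := mem_ballotWords.1 hD
    have hc : ∀ p < n, (p ∈ D ∩ Finset.range n ↔ p ∈ D) := by
      intro p hp
      simp [hp]
    have hn := h2 n (by omega)
    refine Finset.mem_coe.2 (Finset.mem_biUnion.2 ⟨Nat.count (· ∈ D) n,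
      Finset.mem_range.2 (by omega), mem_ballotWords.2
        ⟨Finset.inter_subset_right, count_mem_congr hc le_rfl, fun t ht => ?_⟩⟩)
    rw [count_mem_congr hc ht]
    exact h2 t (by omega)
  · intro D hD E hE h
    obtain ⟨hD, hD'⟩ := Finset.mem_filter.1 hD
    obtain ⟨hE, hE'⟩ := Finset.mem_filter.1 hE
    have hlow : ∀ p < n, (p ∈ D ↔ p ∈ E) := by
      intro p hp
      have := Finset.ext_iff.1 h p
      simpa [hp] using this
    ext p
    by_cases hp : p < n
    · exact hlow p hp
    · rw [← hD', ← hE', reverseWord, reverseWord, Finset.mem_filter, Finset.mem_filter]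
      refine and_congr_right fun h2 => not_congr (hlow _ ?_)
      have := Finset.mem_range.1 h2
      omega

/-- If the elements of `B` are attached to disjoint nonempty subsets of `S` that are stable under
a map `σ`, then `B` has at most as many elements as there are orbits of an involution. -/
theorem two_mul_card_le_of_stable_fibers {α β : Type*} [DecidableEq α] (S : Finset α)
    (B : Finset β) (σ : α → α) (R : α → β → Prop) (hS : ∀ d x, R d x → d ∈ S)
    (hσ : ∀ d x, R d x → R (σ d) x) (hR : ∀ d x y, R d x → R d y → x = y)
    (hB : ∀ x ∈ B, ∃ d, R d x) :
    2 * B.card ≤ S.card + {d ∈ S | σ d = d}.card := by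
  classical
  have hdis : ∀ T : Finset α, ∑ x ∈ B, {d ∈ T | R d x}.card ≤ T.card := by
    intro T
    rw [← Finset.card_biUnion]
    · exact Finset.card_le_card (Finset.biUnion_subset.2 fun x _ => Finset.filter_subset _ _)
    · intro x _ y _ hxy
      refine Finset.disjoint_left.2 fun d h1 h2 => hxy ?_
      exact hR d x y (Finset.mem_filter.1 h1).2 (Finset.mem_filter.1 h2).2
  refine le_trans ?_ (Nat.add_le_add (hdis S) (hdis {d ∈ S | σ d = d}))
  rw [← Finset.sum_add_distrib, mul_comm, ← smul_eq_mul]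
  refine Finset.card_nsmul_le_sum _ _ _ fun x hx => ?_
  obtain ⟨d, hd⟩ := hB x hx
  have h1 : d ∈ ({d ∈ S | R d x} : Finset α) := Finset.mem_filter.2 ⟨hS d x hd, hd⟩
  by_cases h : σ d = d
  · have h2 : d ∈ ({d ∈ ({d ∈ S | σ d = d} : Finset α) | R d x} : Finset α) :=
      Finset.mem_filter.2 ⟨Finset.mem_filter.2 ⟨hS d x hd, h⟩, hd⟩
    have := Finset.card_pos.2 ⟨d, h1⟩
    have := Finset.card_pos.2 ⟨d, h2⟩
    omega
  · have h2 : σ d ∈ ({d ∈ S | R d x} : Finset α) :=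
      Finset.mem_filter.2 ⟨hS _ x (hσ d x hd), hσ d x hd⟩
    have := Finset.one_lt_card.2 ⟨σ d, h2, d, h1, h⟩
    omega

theorem catalan_mono : Monotone catalan := by
  refine monotone_nat_of_le_succ fun n => ?_
  rw [catalan_succ]
  have := Finset.single_le_sum (f := fun i : Fin n.succ => catalan i * catalan (n - i))
    (fun _ _ => Nat.zero_le _) (Finset.mem_univ 0)
  simpa using this

theorem choose_half_mono : Monotone fun n : ℕ => n.choose (n / 2) :=
  monotone_nat_of_le_succ fun n =>
    (Nat.choose_le_choose _ n.le_succ).trans (Nat.choose_le_middle _ _)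

/-- The entries of the infinite lower triangular Toeplitz matrix with first column `a`. -/
def toeplitzEntry {F : Type*} [Zero F] (a : ℕ → F) (r c : ℕ) : F :=
  if c ≤ r then a (r - c) else 0

/-- The square submatrix of the lower triangular Toeplitz matrix with first column `a` that has
rows `i` and columns `j`. -/
def toeplitzSubmatrix {F ι : Type*} [Zero F] (a : ℕ → F) (i j : ι → ℕ) : Matrix ι ι F :=
  Matrix.of fun x y => toeplitzEntry a (i x) (j y)

/-- All proper minors of the leading `m × m` block of a lower triangular Toeplitz matrix are
nonzero. -/
def ProperMinorsNonzero {F : Type*} [CommRing F] (a : ℕ → F) (m : ℕ) : Prop :=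
  ∀ (s : ℕ) (i j : Fin s → ℕ), StrictMono i → StrictMono j → (∀ ν, i ν < m) →
    (∀ ν, j ν ≤ i ν) → (toeplitzSubmatrix a i j).det ≠ 0

/-- The index pairs of the proper submatrices of an `(m + 1) × (m + 1)` lower triangular Toeplitz
matrix that contain the bottom left entry and whose complementary minor is proper. -/
structure IsCornerPair (m : ℕ) {s : ℕ} (i j : Fin (s + 1) → ℕ) : Prop where
  strictMono_row : StrictMono i
  strictMono_col : StrictMono j
  row_last : i (Fin.last s) = m
  col_zero : j 0 = 0
  col_succ_le : ∀ ν : Fin s, j ν.succ ≤ i ν.castSucc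

namespace IsCornerPair

variable {m s : ℕ} {i j : Fin (s + 1) → ℕ}

theorem row_le (h : IsCornerPair m i j) (ν : Fin (s + 1)) : i ν ≤ m :=
  h.row_last ▸ h.strictMono_row.monotone (Fin.le_last ν)

theorem row_castSucc_lt (h : IsCornerPair m i j) (ν : Fin s) : i ν.castSucc < m :=
  h.row_last ▸ h.strictMono_row (Fin.castSucc_lt_last ν)

theorem col_le (h : IsCornerPair m i j) (ν : Fin (s + 1)) : j ν ≤ m := by
  refine Fin.cases ?_ (fun ν => ?_) ν
  · simp [h.col_zero]
  · exact (h.col_succ_le ν).trans (h.row_le _)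

/-- Reflecting a submatrix in the antidiagonal. -/
theorem reflect (h : IsCornerPair m i j) :
    IsCornerPair m (fun ν => m - j ν.rev) (fun ν => m - i ν.rev) where
  strictMono_row := fun x y hxy => by
    have h1 := h.strictMono_col (Fin.rev_lt_rev.2 hxy)
    have h2 := h.col_le x.rev
    dsimp only
    omega
  strictMono_col := fun x y hxy => by
    have h1 := h.strictMono_row (Fin.rev_lt_rev.2 hxy)
    have h2 := h.row_le x.rev
    dsimp only
    omega
  row_last := by simp [h.col_zero]
  col_zero := by simp [h.row_last]
  col_succ_le := fun ν => by
    rw [Fin.rev_succ, Fin.rev_castSucc]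
    exact Nat.sub_le_sub_left (h.col_succ_le _) _

theorem det_reflect {F : Type*} [CommRing F] (a : ℕ → F) (h : IsCornerPair m i j) :
    (toeplitzSubmatrix a (fun ν : Fin (s + 1) => m - j ν.rev) (fun ν => m - i ν.rev)).det =
      (toeplitzSubmatrix a i j).det := by
  have : toeplitzSubmatrix a (fun ν => m - j ν.rev) (fun ν => m - i ν.rev) =
      (toeplitzSubmatrix a i j).transpose.submatrix Fin.revPerm Fin.revPerm := by
    ext x y
    have h1 := h.row_le y.rev
    have h2 := h.col_le x.rev
    simp only [toeplitzSubmatrix, toeplitzEntry, Matrix.of_apply, Matrix.submatrix_apply,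
      Matrix.transpose_apply, Fin.revPerm_apply]
    rw [show m - j x.rev - (m - i y.rev) = i y.rev - j x.rev by omega]
    exact if_congr (by omega) rfl rfl
  rw [this, Matrix.det_submatrix_equiv_self, Matrix.det_transpose]

end IsCornerPair

/-- The positions of the down-steps of the lattice word of length `2 * m` that records membership
in `I` at even positions and non-membership in `J` at odd positions. -/
def pairWord (m : ℕ) (I J : Finset ℕ) : Finset ℕ :=
  {p ∈ Finset.range (2 * m) | if p % 2 = 0 then p / 2 ∈ I else (p + 1) / 2 ∉ J}

section pairWord

variable {m u : ℕ} {I J : Finset ℕ}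

theorem two_mul_mem_pairWord (hu : u < m) : 2 * u ∈ pairWord m I J ↔ u ∈ I := by
  simp [pairWord, hu]

theorem two_mul_add_one_mem_pairWord (hu : u < m) :
    2 * u + 1 ∈ pairWord m I J ↔ u + 1 ∉ J := by
  have h1 : (2 * u + 1) % 2 = 1 := by omega
  have h2 : (2 * u + 1 + 1) / 2 = u + 1 := by omega
  have h3 : 2 * u + 1 < 2 * m := by omega
  simp [pairWord, h1, h2, h3]

theorem count_pairWord (h0 : 0 ∈ J) (hu : u ≤ m) :
    Nat.count (· ∈ pairWord m I J) (2 * u) + Nat.count (· ∈ J) (u + 1) =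
      Nat.count (· ∈ I) u + u + 1 := by
  induction u with
  | zero => simp [Nat.count_succ, h0]
  | succ u ih =>
    have ih := ih (by omega)
    have h1 := two_mul_mem_pairWord (I := I) (J := J) (Nat.lt_of_succ_le hu)
    have h2 := two_mul_add_one_mem_pairWord (I := I) (J := J) (Nat.lt_of_succ_le hu)
    rw [show 2 * (u + 1) = 2 * u + 1 + 1 by ring, Nat.count_succ, Nat.count_succ,
      Nat.count_succ (· ∈ J), Nat.count_succ (· ∈ I)]
    simp only [h1, h2]
    by_cases h3 : u ∈ I <;> by_cases h4 : u + 1 ∈ J <;> simp only [h3, h4] <;> simp <;> omega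

end pairWord

namespace IsCornerPair

variable {m s : ℕ} {i j : Fin (s + 1) → ℕ}

/-- The lattice word attached to the index pair of a submatrix. -/
def word (m : ℕ) {s : ℕ} (i j : Fin s → ℕ) : Finset ℕ :=
  pairWord m (Finset.univ.image i) (Finset.univ.image j)

theorem count_image {s : ℕ} {i : Fin s → ℕ} (hi : StrictMono i) (u : ℕ) :
    Nat.count (· ∈ Finset.univ.image i) u = ({ν | i ν < u} : Finset (Fin s)).card := by
  rw [Nat.count_eq_card_filter_range, ← Finset.card_image_of_injective _ hi.injective]
  congr 1
  ext p
  simp only [Finset.mem_filter, Finset.mem_range, Finset.mem_image, Finset.mem_univ, true_and]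
  constructor
  · rintro ⟨hp, ν, rfl⟩
    exact ⟨ν, hp, rfl⟩
  · rintro ⟨ν, hp, rfl⟩
    exact ⟨hp, ν, rfl⟩

theorem count_row_lt_count_col (h : IsCornerPair m i j) {u : ℕ} (hu : u < m) :
    Nat.count (· ∈ Finset.univ.image i) (u + 1) + 1 ≤
      Nat.count (· ∈ Finset.univ.image j) (u + 1) := by
  rw [count_image h.strictMono_row, count_image h.strictMono_col]
  have h1 : ({ν | i ν < u + 1} : Finset (Fin (s + 1))) =
      ({ν | i ν.castSucc < u + 1} : Finset (Fin s)).map Fin.castSuccEmb := by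
    ext ν
    simp only [Finset.mem_filter, Finset.mem_univ, true_and, Finset.mem_map]
    constructor
    · refine Fin.lastCases (fun hν => ?_) (fun ν hν => ⟨ν, hν, rfl⟩) ν
      rw [h.row_last] at hν
      omega
    · rintro ⟨ν, hν, rfl⟩
      exact hν
  have h2 : insert 0 (({ν | i ν.castSucc < u + 1} : Finset (Fin s)).map (Fin.succEmb s)) ⊆
      ({ν | j ν < u + 1} : Finset (Fin (s + 1))) := by
    intro ν hν
    simp only [Finset.mem_filter, Finset.mem_univ, true_and, Finset.mem_map,
      Finset.mem_insert] at hν ⊢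
    rcases hν with rfl | ⟨ν, hν, rfl⟩
    · rw [h.col_zero]
      omega
    · exact (h.col_succ_le ν).trans_lt hν
  have h3 := Finset.card_le_card h2
  rw [Finset.card_insert_of_notMem (by simp [Fin.succ_ne_zero]), Finset.card_map] at h3
  rwa [h1, Finset.card_map]

theorem zero_mem_image_col (h : IsCornerPair m i j) : 0 ∈ Finset.univ.image j :=
  Finset.mem_image.2 ⟨0, Finset.mem_univ _, h.col_zero⟩

theorem word_mem_ballotWords (h : IsCornerPair m i j) : word m i j ∈ ballotWords (2 * m) m := by
  have hodd : ∀ u < m, Nat.count (· ∈ word m i j) (2 * u + 1) ≤ u := by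
    intro u hu
    have h1 := count_pairWord (I := Finset.univ.image i) h.zero_mem_image_col hu.le
    have h2 := h.count_row_lt_count_col hu
    have h3 := two_mul_mem_pairWord (I := Finset.univ.image i) (J := Finset.univ.image j) hu
    rw [Nat.count_succ (· ∈ Finset.univ.image i)] at h2
    rw [Nat.count_succ, word]
    simp only [h3]
    omega
  refine mem_ballotWords.2 ⟨Finset.filter_subset _ _, ?_, fun t ht => ?_⟩
  · have h1 := count_pairWord (I := Finset.univ.image i) h.zero_mem_image_col (le_refl m)
    rw [count_image h.strictMono_row, count_image h.strictMono_col] at h1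
    have h2 : ({ν | j ν < m + 1} : Finset (Fin (s + 1))) = Finset.univ := by
      simp [h.col_le]
    have h3 : ({ν | i ν < m} : Finset (Fin (s + 1))) = Finset.univ.erase (Fin.last s) := by
      ext ν
      refine Fin.lastCases ?_ (fun ν => ?_) ν
      · simp [h.row_last]
      · simp [h.row_castSucc_lt, Fin.castSucc_ne_last]
    rw [h2, h3, Finset.card_erase_of_mem (Finset.mem_univ _)] at h1
    simp only [Finset.card_univ, Fintype.card_fin] at h1
    rw [word]
    omega
  · obtain ⟨u, rfl | rfl⟩ := Nat.even_or_odd' t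
    · cases u with
      | zero => simp
      | succ u =>
        have h1 := hodd u (by omega)
        rw [show 2 * (u + 1) = 2 * u + 1 + 1 by ring, Nat.count_succ]
        split_ifs <;> omega
    · have h1 := hodd u (by omega)
      omega

theorem word_reflect (h : IsCornerPair m i j) :
    word m (fun ν => m - j ν.rev) (fun ν => m - i ν.rev) = reverseWord m (word m i j) := by
  have mem_image_reflect : ∀ f : Fin (s + 1) → ℕ, (∀ ν, f ν ≤ m) → ∀ u v, u + v = m →
      (u ∈ Finset.univ.image (fun ν : Fin (s + 1) => m - f ν.rev) ↔
        v ∈ Finset.univ.image f) := by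
    intro f hf u v huv
    simp only [Finset.mem_image, Finset.mem_univ, true_and]
    constructor
    · rintro ⟨ν, hν⟩
      have := hf ν.rev
      exact ⟨ν.rev, by omega⟩
    · rintro ⟨ν, hν⟩
      exact ⟨ν.rev, by rw [Fin.rev_rev]; omega⟩
  ext p
  by_cases hp : p < 2 * m
  · have hrev : p ∈ reverseWord m (word m i j) ↔ 2 * m - 1 - p ∉ word m i j := by
      simp [reverseWord, hp]
    rw [hrev]
    obtain ⟨u, rfl | rfl⟩ := Nat.even_or_odd' p
    · rw [show 2 * m - 1 - 2 * u = 2 * (m - 1 - u) + 1 by omega, word, word,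
        two_mul_mem_pairWord (by omega), two_mul_add_one_mem_pairWord (by omega), not_not]
      exact mem_image_reflect j h.col_le _ _ (by omega)
    · rw [show 2 * m - 1 - (2 * u + 1) = 2 * (m - 1 - u) by omega, word, word,
        two_mul_mem_pairWord (by omega), two_mul_add_one_mem_pairWord (by omega)]
      exact not_congr (mem_image_reflect i h.row_le _ _ (by omega))
  · simp [reverseWord, word, pairWord, hp]

theorem mem_image_row_iff (h : IsCornerPair m i j) (u : ℕ) :
    u ∈ Finset.univ.image i ↔ u = m ∨ u < m ∧ 2 * u ∈ word m i j := by
  rcases lt_trichotomy u m with hu | rfl | hu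
  · rw [word, two_mul_mem_pairWord hu]
    simp only [hu, hu.ne, true_and, false_or]
  · simpa using ⟨_, h.row_last⟩
  · simp only [hu.ne', hu.not_gt, false_and, or_false, iff_false, Finset.mem_image, not_exists,
      Finset.mem_univ, true_and]
    intro ν hν
    have := h.row_le ν
    omega

theorem mem_image_col_iff (h : IsCornerPair m i j) (u : ℕ) :
    u ∈ Finset.univ.image j ↔ u = 0 ∨ u ≤ m ∧ 2 * (u - 1) + 1 ∉ word m i j := by
  cases u with
  | zero => simpa using ⟨0, h.col_zero⟩
  | succ u =>
    by_cases hu : u < m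
    · rw [Nat.add_sub_cancel, word, two_mul_add_one_mem_pairWord hu]
      simp only [Nat.succ_le_iff, hu, true_and, not_not, Nat.succ_ne_zero, false_or]
    · simp only [Nat.succ_le_iff, hu, false_and, or_false, Nat.succ_ne_zero, iff_false,
        Finset.mem_image, not_exists, Finset.mem_univ, true_and]
      intro ν hν
      have := h.col_le ν
      omega

theorem exists_eq_of_word_eq {s' : ℕ} {i' j' : Fin (s' + 1) → ℕ} (h : IsCornerPair m i j)
    (h' : IsCornerPair m i' j') (hw : word m i j = word m i' j') :
    ∃ e : s' = s, i' = i ∘ Fin.cast (by rw [e]) ∧ j' = j ∘ Fin.cast (by rw [e]) := by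
  have hi : Finset.univ.image i = Finset.univ.image i' := by
    ext u
    rw [h.mem_image_row_iff, h'.mem_image_row_iff, hw]
  have hj : Finset.univ.image j = Finset.univ.image j' := by
    ext u
    rw [h.mem_image_col_iff, h'.mem_image_col_iff, hw]
  have hs := congrArg Finset.card hi
  rw [Finset.card_image_of_injective _ h.strictMono_row.injective,
    Finset.card_image_of_injective _ h'.strictMono_row.injective] at hs
  simp only [Finset.card_univ, Fintype.card_fin, Nat.add_right_cancel_iff] at hs
  subst hs
  refine ⟨rfl, ?_, ?_⟩
  · refine (h'.strictMono_row.range_inj h.strictMono_row).1 ?_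
    simpa using (congrArg (fun T : Finset ℕ => (T : Set ℕ)) hi).symm
  · refine (h'.strictMono_col.range_inj h.strictMono_col).1 ?_
    simpa using (congrArg (fun T : Finset ℕ => (T : Set ℕ)) hj).symm

end IsCornerPair

section minors

variable {F : Type*}

theorem toeplitzSubmatrix_update_of_ne [Zero F] {ι : Type*} (a : ℕ → F) (m : ℕ) (x : F)
    {i j : ι → ℕ} (h : ∀ y z, i y - j z ≠ m) :
    toeplitzSubmatrix (Function.update a m x) i j = toeplitzSubmatrix a i j := by
  ext y z
  simp [toeplitzSubmatrix, toeplitzEntry, Function.update_of_ne (h y z)]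

theorem ProperMinorsNonzero.update [CommRing F] {a : ℕ → F} {m : ℕ}
    (h : ProperMinorsNonzero a m) (x : F) :
    ProperMinorsNonzero (Function.update a m x) m := by
  intro s i j hi hj him hji
  rw [toeplitzSubmatrix_update_of_ne]
  · exact h s i j hi hj him hji
  · intro y z
    have := him y
    omega

/-- Proper minors whose index set is any finite linear order, with rows and columns possibly
shifted. -/
theorem ProperMinorsNonzero.det_ne_zero [CommRing F] {a : ℕ → F} {m : ℕ}
    (h : ProperMinorsNonzero a m) {ι : Type*} [LinearOrder ι] [Fintype ι] (d : ℕ) {i j : ι → ℕ}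
    (hi : StrictMono i) (hj : StrictMono j) (him : ∀ ν, i ν < m + d) (hji : ∀ ν, j ν ≤ i ν)
    (hd : ∀ ν, d ≤ j ν) : (toeplitzSubmatrix a i j).det ≠ 0 := by
  let e := Fintype.orderIsoFinOfCardEq ι rfl
  have h1 : (toeplitzSubmatrix a i j).submatrix e.toEquiv e.toEquiv =
      toeplitzSubmatrix a (fun ν => i (e ν) - d) (fun ν => j (e ν) - d) := by
    ext x y
    have h2 := hd (e x)
    have h3 := hd (e y)
    have h4 := hji (e x)
    simp only [toeplitzSubmatrix, toeplitzEntry, Matrix.of_apply, Matrix.submatrix_apply,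
      RelIso.coe_fn_toEquiv]
    rw [show i (e x) - d - (j (e y) - d) = i (e x) - j (e y) by omega]
    exact if_congr (by omega) rfl rfl
  rw [← Matrix.det_submatrix_equiv_self e.toEquiv, h1]
  refine h _ _ _ (fun x y hxy => ?_) (fun x y hxy => ?_) (fun ν => ?_) (fun ν => ?_)
  · have := hi (e.strictMono hxy)
    have := hd (e x)
    have := hji (e x)
    omega
  · have := hj (e.strictMono hxy)
    have := hd (e x)
    omega
  · have := him (e ν)
    have := hd (e ν)
    have := hji (e ν)
    omega
  · exact Nat.sub_le_sub_right (hji _) _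

theorem IsCornerPair.eq_of_det_update_eq_zero [CommRing F] [IsDomain F] {a : ℕ → F} {m s : ℕ}
    {i j : Fin (s + 1) → ℕ} (ha : ProperMinorsNonzero a m) (h : IsCornerPair m i j) {x y : F}
    (hx : (toeplitzSubmatrix (Function.update a m x) i j).det = 0)
    (hy : (toeplitzSubmatrix (Function.update a m y) i j).det = 0) : x = y := by
  set M := toeplitzSubmatrix (Function.update a m y) i j with hM
  have h1 : toeplitzSubmatrix (Function.update a m x) i j =
      M.updateRow (Fin.last s) (M (Fin.last s) + (x - y) • Pi.single 0 1) := by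
    ext p q
    refine Fin.lastCases ?_ (fun p => ?_) p
    · rw [Matrix.updateRow_self]
      refine Fin.cases ?_ (fun q => ?_) q
      · simp [hM, toeplitzSubmatrix, toeplitzEntry, h.row_last, h.col_zero]
      · have h2 : 0 < j q.succ := h.col_zero ▸ h.strictMono_col q.succ_pos
        have h3 := h.col_le q.succ
        have h4 : m - j q.succ ≠ m := by omega
        simp [hM, toeplitzSubmatrix, toeplitzEntry, h.row_last, Function.update_of_ne h4]
    · rw [Matrix.updateRow_ne (Fin.castSucc_ne_last p)]
      have h2 := h.row_castSucc_lt p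
      have h4 : i p.castSucc - j q ≠ m := by omega
      simp [hM, toeplitzSubmatrix, toeplitzEntry, Function.update_of_ne h4]
  have h2 : M.submatrix Fin.castSucc Fin.succ =
      toeplitzSubmatrix a (i ∘ Fin.castSucc) (j ∘ Fin.succ) := by
    rw [← toeplitzSubmatrix_update_of_ne a m y]
    · rfl
    · intro p q
      have := h.row_castSucc_lt p
      simp only [Function.comp_apply]
      omega
  have h3 : (M.submatrix Fin.castSucc Fin.succ).det ≠ 0 := by
    rw [h2]
    exact ha _ _ _ (h.strictMono_row.comp Fin.strictMono_castSucc)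
      (h.strictMono_col.comp Fin.strictMono_succ) h.row_castSucc_lt h.col_succ_le
  rw [h1, Matrix.det_updateRow_add, Matrix.det_updateRow_smul, Matrix.updateRow_eq_self, hy,
    zero_add, ← Matrix.adjugate_apply, Matrix.adjugate_fin_succ_eq_det_submatrix,
    Fin.succAbove_last, Fin.succAbove_zero] at hx
  have h4 : (-1 : F) ^ ((Fin.last s : ℕ) + ((0 : Fin (s + 1)) : ℕ)) ≠ 0 :=
    pow_ne_zero _ (neg_ne_zero.2 one_ne_zero)
  exact sub_eq_zero.1 ((mul_eq_zero.1 hx).resolve_right (mul_ne_zero h4 h3))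

/-- To enlarge the leading block by one row and column, only the minors of corner pairs have to be
checked: every other proper minor is a product of smaller ones. -/
theorem ProperMinorsNonzero.succ [CommRing F] [IsDomain F] {a : ℕ → F} {m : ℕ}
    (ha : ProperMinorsNonzero a m)
    (h : ∀ (s : ℕ) (i j : Fin (s + 1) → ℕ), IsCornerPair m i j →
      (toeplitzSubmatrix a i j).det ≠ 0) : ProperMinorsNonzero a (m + 1) := by
  intro s i j hi hj him hji
  cases s with
  | zero => simp
  | succ s =>
    by_cases hlast : i (Fin.last s) = m
    swap
    · refine ha _ i j hi hj (fun ν => ?_) hji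
      have := hi.monotone (Fin.le_last ν)
      have := him (Fin.last s)
      omega
    by_cases hzero : j 0 = 0
    swap
    · refine ha.det_ne_zero 1 hi hj him hji fun ν => ?_
      have := hj.monotone (Fin.zero_le ν)
      omega
    by_cases hcorner : ∀ ν : Fin s, j ν.succ ≤ i ν.castSucc
    · exact h s i j ⟨hi, hj, hlast, hzero, hcorner⟩
    push Not at hcorner
    obtain ⟨ν, hν⟩ := hcorner
    rw [Matrix.twoBlockTriangular_det' _ (fun x => x ≤ ν.castSucc)]
    · refine mul_ne_zero ?_ ?_
      · refine ha.det_ne_zero 0 (ι := {x // x ≤ ν.castSucc}) (i := fun x => i x)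
          (j := fun x => j x) (fun x y hxy => hi hxy) (fun x y hxy => hj hxy) (fun x => ?_)
          (fun x => hji x) (fun x => Nat.zero_le _)
        have := hi (x.2.trans_lt (Fin.castSucc_lt_last ν))
        omega
      · refine ha.det_ne_zero 1 (ι := {x // ¬ x ≤ ν.castSucc}) (i := fun x => i x)
          (j := fun x => j x) (fun x y hxy => hi hxy) (fun x y hxy => hj hxy) (fun x => him x)
          (fun x => hji x) (fun x => ?_)
        have := hj ((Fin.zero_le _).trans_lt (not_le.1 x.2))
        omega
    · intro x hx y hy
      have h1 := hi.monotone hx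
      have h2 := hj.monotone (Fin.castSucc_lt_iff_succ_le.1 (not_le.1 hy))
      simp only [toeplitzSubmatrix, toeplitzEntry, Matrix.of_apply]
      exact if_neg (by omega)

theorem ProperMinorsNonzero.exists_update [CommRing F] [IsDomain F] [Fintype F] {a : ℕ → F}
    {m : ℕ} (ha : ProperMinorsNonzero a m)
    (hF : catalan m + m.choose (m / 2) < 2 * Fintype.card F) :
    ∃ x, ProperMinorsNonzero (Function.update a m x) (m + 1) := by
  classical
  let B : Finset F := {x | ∃ (s : ℕ) (i j : Fin (s + 1) → ℕ), IsCornerPair m i j ∧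
    (toeplitzSubmatrix (Function.update a m x) i j).det = 0}
  have hB : 2 * B.card ≤ (ballotWords (2 * m) m).card +
      {D ∈ ballotWords (2 * m) m | reverseWord m D = D}.card := by
    refine two_mul_card_le_of_stable_fibers _ B (reverseWord m)
      (fun D x => ∃ (s : ℕ) (i j : Fin (s + 1) → ℕ), IsCornerPair m i j ∧
        IsCornerPair.word m i j = D ∧
        (toeplitzSubmatrix (Function.update a m x) i j).det = 0) ?_ ?_ ?_ ?_
    · rintro _ x ⟨s, i, j, h, rfl, -⟩
      exact h.word_mem_ballotWords
    · rintro _ x ⟨s, i, j, h, rfl, hx⟩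
      exact ⟨s, _, _, h.reflect, h.word_reflect, (h.det_reflect _).trans hx⟩
    · rintro _ x y ⟨s, i, j, h, rfl, hx⟩ ⟨s', i', j', h', hw, hy⟩
      obtain ⟨rfl, rfl, rfl⟩ := h.exists_eq_of_word_eq h' hw.symm
      exact h.eq_of_det_update_eq_zero ha hx hy
    · intro x hx
      obtain ⟨s, i, j, h, hx⟩ := (Finset.mem_filter.1 hx).2
      exact ⟨_, s, i, j, h, rfl, hx⟩
  have h1 := card_ballotWords_le_catalan m
  have h2 := card_symmetric_ballotWords_le m
  obtain ⟨x, hx⟩ : ∃ x, x ∉ B := by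
    by_contra! hall
    rw [Finset.eq_univ_iff_forall.2 hall, Finset.card_univ] at hB
    omega
  refine ⟨x, (ha.update x).succ fun s i j h h0 => hx ?_⟩
  exact Finset.mem_filter.2 ⟨Finset.mem_univ _, s, i, j, h, h0⟩

theorem exists_properMinorsNonzero [CommRing F] [IsDomain F] [Fintype F] (n : ℕ)
    (hF : catalan n + n.choose (n / 2) < 2 * Fintype.card F) (m : ℕ) (hm : m ≤ n + 1) :
    ∃ a : ℕ → F, ProperMinorsNonzero a m := by
  induction m with
  | zero =>
    refine ⟨0, fun s i j _ _ him _ => ?_⟩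
    cases s with
    | zero => simp
    | succ s => exact absurd (him 0) (Nat.not_lt_zero _)
  | succ m ih =>
    obtain ⟨a, ha⟩ := ih (by omega)
    have h1 := catalan_mono (show m ≤ n by omega)
    have h2 := choose_half_mono (show m ≤ n by omega)
    dsimp only at h2
    obtain ⟨x, hx⟩ := ha.exists_update (by omega)
    exact ⟨_, hx⟩

end minors

/-- If a finite field `F` satisfies
`|F| > (1/2)·(C_{γ-1} + binom(γ-1, ⌊(γ-1)/2⌋))`, where `C_n = (1/(n+1))·binom(2n, n)`
is the `n`-th Catalan number, then there is a `γ × γ` superregular matrix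
over `F`. -/
theorem exists_superregular_of_large_field {γ : ℕ} (hγ : 1 ≤ γ)
    {F : Type*} [Field F] [Fintype F]
    (hcard : (1 / 2 : ℚ) *
        ((1 / (((γ - 1 : ℕ) : ℚ) + 1)) * (Nat.choose (2 * (γ - 1)) (γ - 1) : ℚ) +
          (Nat.choose (γ - 1) ((γ - 1) / 2) : ℚ)) < (Fintype.card F : ℚ)) :
    ∃ A : Matrix (Fin γ) (Fin γ) F, Superregular A := by
  obtain ⟨n, rfl⟩ : ∃ n, γ = n + 1 := ⟨γ - 1, by omega⟩
  rw [Nat.add_sub_cancel] at hcard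
  have hcat : (1 / ((n : ℚ) + 1)) * (Nat.choose (2 * n) n : ℚ) = catalan n := by
    have h := succ_mul_catalan_eq_centralBinom n
    rw [Nat.centralBinom] at h
    rw [← h]
    push_cast
    field_simp
  rw [hcat] at hcard
  have hF : catalan n + n.choose (n / 2) < 2 * Fintype.card F := by
    have : ((catalan n : ℚ) + (n.choose (n / 2) : ℚ)) < 2 * (Fintype.card F : ℚ) := by linarith
    exact_mod_cast this
  obtain ⟨a, ha⟩ := exists_properMinorsNonzero (F := F) n hF (n + 1) le_rfl
  refine ⟨toeplitzSubmatrix a (fun r => r) (fun c => c), ⟨a, fun r c => rfl⟩, ?_⟩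
  intro s i j hi hj hji
  exact ha s (fun ν => i ν) (fun ν => j ν) (fun x y hxy => hi hxy) (fun x y hxy => hj hxy)
    (fun ν => (i ν).2) hji
end
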